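/- Let Ω ⊂ ℂ be a domain and ω ∈ L²_loc(Ω) satisfy the weak reverse Hölder inequality ((1/r²)∫_B ω² dm)^{1/2} ≤ (c/r²)∫_{2B}|ω| dm for every disk B = D(a,r) with D(a,2r) ⊂ Ω, with a fixed constant c. Then almost every zero of ω is a zero of infinite order: for almost every z₀ ∈ {z ∈ Ω : ω(z) = 0} and every positive integer N, there exists r₀ = r₀(z₀,N) > 0 with D(z₀,2r₀) ⊂ Ω such that for all 0 < r ≤ r₀, ∫_{D(z₀,r)} |ω| dm ≤ (r^N / r₀^N) ∫_{D(z₀,2r₀)} |ω| dm; in particular ∫_{D(z₀,r)}|ω| dm = O(r^N) as r → 0. -/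

import Mathlib

open MeasureTheory Metric Complex

noncomputable section

/-- A smooth real-valued test function compactly supported in `Ω`. -/
def IsTestFun (Ω : Set ℂ) (φ : ℂ → ℝ) : Prop :=
  ContDiff ℝ (⊤ : ℕ∞) φ ∧ HasCompactSupport φ ∧ tsupport φ ⊆ Ω

/-- The directional derivative of a smooth function in direction `e`. -/
def pd (e : ℂ) (φ : ℂ → ℝ) : ℂ → ℝ := fun z => fderiv ℝ φ z e

/-- `g` is the weak partial derivative of the complex-valued `f` in direction `e` on `Ω`. -/
def HasWeakPartial (Ω : Set ℂ) (e : ℂ) (f g : ℂ → ℂ) : Prop :=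
  ∀ φ : ℂ → ℝ, IsTestFun Ω φ →
    ∫ z in Ω, (pd e φ z) • f z = - ∫ z in Ω, (φ z) • g z

/-- `g` is the weak partial derivative of the real-valued `f` in direction `e` on `Ω`. -/
def HasWeakPartialR (Ω : Set ℂ) (e : ℂ) (f g : ℂ → ℝ) : Prop :=
  ∀ φ : ℂ → ℝ, IsTestFun Ω φ →
    ∫ z in Ω, (pd e φ z) * f z = - ∫ z in Ω, (φ z) * g z

/-- Locally square integrable on `Ω`. -/
def MemL2Loc (Ω : Set ℂ) (g : ℂ → ℂ) : Prop :=
  ∀ K : Set ℂ, K ⊆ Ω → IsCompact K → IntegrableOn (fun z => ‖g z‖ ^ 2) K volume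

def MemL2LocR (Ω : Set ℂ) (g : ℂ → ℝ) : Prop :=
  ∀ K : Set ℂ, K ⊆ Ω → IsCompact K → IntegrableOn (fun z => (g z) ^ 2) K volume

/-- `f ∈ W^{1,2}_loc(Ω; ℂ)` with weak partial derivatives `fx`, `fy`. -/
structure W12Loc (Ω : Set ℂ) (f fx fy : ℂ → ℂ) : Prop where
  meas : AEStronglyMeasurable f (volume.restrict Ω)
  l2f : MemL2Loc Ω f
  hx : HasWeakPartial Ω 1 f fx
  hy : HasWeakPartial Ω Complex.I f fy
  l2x : MemL2Loc Ω fx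
  l2y : MemL2Loc Ω fy

/-- Wirtinger derivative `∂/∂z` computed from weak partials. -/
def wz (fx fy : ℂ → ℂ) : ℂ → ℂ := fun z => (fx z - Complex.I * fy z) / 2

/-- Wirtinger derivative `∂/∂z̄` computed from weak partials. -/
def wzbar (fx fy : ℂ → ℂ) : ℂ → ℂ := fun z => (fx z + Complex.I * fy z) / 2


/-- `ω` satisfies a weak reverse Hölder inequality on `Ω` with constant `c`. -/
def WeakReverseHolder (Ω : Set ℂ) (ω : ℂ → ℝ) (c : ℝ) : Prop :=
  ∀ (a : ℂ) (r : ℝ), 0 < r → ball a (2 * r) ⊆ Ω →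
    Real.sqrt ((1 / r ^ 2) * ∫ z in ball a r, (ω z) ^ 2) ≤
      (c / r ^ 2) * ∫ z in ball a (2 * r), |ω z|

section Auxiliary

open Filter Topology

lemma sq_integral_abs_le {α : Type*} [MeasurableSpace α] (μ : Measure α) [IsFiniteMeasure μ]
    {f : α → ℝ} (hf : Integrable (fun x => |f x|) μ) (hf2 : Integrable (fun x => f x ^ 2) μ) :
    (∫ x, |f x| ∂μ) ^ 2 ≤ μ.real Set.univ * ∫ x, f x ^ 2 ∂μ := by
  have hquad : ∀ t : ℝ, 0 ≤ μ.real Set.univ * (t * t) + (-2 * ∫ x, |f x| ∂μ) * t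
      + ∫ x, f x ^ 2 ∂μ := by
    intro t
    have hnonneg : 0 ≤ ∫ x, (t * t - 2 * t * |f x| + f x ^ 2) ∂μ :=
      integral_nonneg fun x => by
        have := sq_nonneg (t - |f x|)
        have := sq_abs (f x)
        simp only [Pi.zero_apply]
        nlinarith
    have hlin : Integrable (fun x => t * t - 2 * t * |f x|) μ :=
      (integrable_const _).sub (hf.const_mul _)
    rw [integral_add hlin hf2, integral_sub (integrable_const _) (hf.const_mul _),
      integral_const, integral_const_mul,
      smul_eq_mul] at hnonneg
    linarith
  have hdiscrim := discrim_le_zero hquad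
  unfold discrim at hdiscrim
  linarith

lemma MemL2LocR.aestronglyMeasurable_abs {Ω : Set ℂ} {ω : ℂ → ℝ} (hω : MemL2LocR Ω ω)
    {K : Set ℂ} (hKΩ : K ⊆ Ω) (hK : IsCompact K) :
    AEStronglyMeasurable (fun z => |ω z|) (volume.restrict K) := by
  simpa only [Function.comp_def, Real.sqrt_sq_eq_abs] using
    Real.continuous_sqrt.comp_aestronglyMeasurable (hω K hKΩ hK).aestronglyMeasurable

lemma MemL2LocR.integrableOn_abs {Ω : Set ℂ} {ω : ℂ → ℝ} (hω : MemL2LocR Ω ω)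
    {K : Set ℂ} (hKΩ : K ⊆ Ω) (hK : IsCompact K) :
    IntegrableOn (fun z => |ω z|) K := by
  have hfin : IsFiniteMeasure (volume.restrict K) := ⟨by simpa using hK.measure_lt_top⟩
  refine ((integrable_const (1 : ℝ)).add (hω K hKΩ hK)).mono'
    (hω.aestronglyMeasurable_abs hKΩ hK) (Eventually.of_forall fun z => ?_)
  have := sq_nonneg (|ω z| - 1)
  have := sq_abs (ω z)
  have := abs_nonneg (ω z)
  simp only [Real.norm_eq_abs, abs_abs, Pi.add_apply]
  nlinarith

lemma MemL2LocR.measure_support_add_zeros {Ω : Set ℂ} {ω : ℂ → ℝ} (hω : MemL2LocR Ω ω)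
    {K : Set ℂ} (hKΩ : K ⊆ Ω) (hK : IsCompact K) :
    volume ({z ∈ Ω | ω z = 0} ∩ K) + volume.restrict K {z | ω z ≠ 0} = volume K := by
  have hnull : NullMeasurableSet {z | ω z = 0} (volume.restrict K) := by
    have := (hω.aestronglyMeasurable_abs hKΩ hK).aemeasurable.nullMeasurable
      (measurableSet_singleton (0 : ℝ))
    simpa [Set.preimage] using this
  have hzeros : {z ∈ Ω | ω z = 0} ∩ K = {z | ω z = 0} ∩ K := by
    ext z
    simp only [Set.mem_inter_iff, Set.mem_ofPred_eq]
    exact ⟨fun h => ⟨h.1.2, h.2⟩, fun h => ⟨⟨hKΩ h.2, h.1⟩, h.2⟩⟩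
  rw [hzeros, ← Measure.restrict_apply₀ hnull]
  simpa [Set.compl_ofPred] using measure_add_measure_compl₀ hnull

/-- Near a point where the zero set has density close to one, the weak reverse Hölder
inequality forces the mean of `|ω|` over a disk to be small compared to the double disk. -/
lemma WeakReverseHolder.sq_integral_abs_le {Ω : Set ℂ} {ω : ℂ → ℝ} {c : ℝ}
    (hwrh : WeakReverseHolder Ω ω c) (hω : MemL2LocR Ω ω) {a : ℂ} {r η : ℝ} (hr : 0 < r)
    (hball : ball a (2 * r) ⊆ Ω)
    (hdens : volume.restrict (closedBall a r) {z | ω z ≠ 0} ≤ ENNReal.ofReal (η * r ^ 2))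
    (hη : 0 ≤ η) :
    (∫ z in ball a r, |ω z|) ^ 2 ≤ η * c ^ 2 * (∫ z in ball a (2 * r), |ω z|) ^ 2 := by
  have hKΩ : closedBall a r ⊆ Ω := (closedBall_subset_ball (by linarith)).trans hball
  have hK := isCompact_closedBall a r
  set S : Set ℂ := {z | ω z ≠ 0}
  set μ := (volume.restrict (ball a r)).restrict S
  have hfin : IsFiniteMeasure (volume.restrict (ball a r)) :=
    ⟨by simpa using measure_ball_lt_top (μ := volume) (x := a) (r := r)⟩
  have hcs := _root_.sq_integral_abs_le μ
    (((hω.integrableOn_abs hKΩ hK).mono_set ball_subset_closedBall).integrable.mono_measure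
      Measure.restrict_le_self)
    (((hω _ hKΩ hK).mono_set ball_subset_closedBall).integrable.mono_measure
      Measure.restrict_le_self)
  rw [setIntegral_eq_integral_of_forall_compl_eq_zero (s := S)
      (fun z hz => by simpa [S] using hz),
    setIntegral_eq_integral_of_forall_compl_eq_zero (s := S)
      (fun z hz => by simpa [S] using hz)] at hcs
  have hμ : μ.real Set.univ ≤ η * r ^ 2 := by
    refine ENNReal.toReal_le_of_le_ofReal (by positivity) ?_
    rw [Measure.restrict_apply_univ]
    exact (Measure.restrict_mono_set volume ball_subset_closedBall S).trans hdens
  set I := ∫ z in ball a r, (ω z) ^ 2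
  set F := ∫ z in ball a (2 * r), |ω z|
  have hI : 0 ≤ I := integral_nonneg fun z => sq_nonneg _
  have hsqrt := pow_le_pow_left₀ (Real.sqrt_nonneg _) (hwrh a r hr hball) 2
  rw [Real.sq_sqrt (by positivity)] at hsqrt
  have hrI : r ^ 2 * I ≤ c ^ 2 * F ^ 2 := by
    have h := mul_le_mul_of_nonneg_left hsqrt (by positivity : 0 ≤ r ^ 4)
    have hl : r ^ 4 * (1 / r ^ 2 * I) = r ^ 2 * I := by field_simp
    have hrhs : r ^ 4 * (c / r ^ 2 * F) ^ 2 = c ^ 2 * F ^ 2 := by field_simp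
    rwa [hl, hrhs] at h
  calc _ ≤ μ.real Set.univ * I := hcs
    _ ≤ η * r ^ 2 * I := by gcongr
    _ = η * (r ^ 2 * I) := by ring
    _ ≤ η * (c ^ 2 * F ^ 2) := by gcongr
    _ = _ := by ring

lemma le_pow_mul_of_doubling {F : ℝ → ℝ} {r₀ : ℝ} {N : ℕ}
    (hF : ∀ r, 0 < r → r ≤ r₀ → F r ≤ (1 / 2) ^ N * F (2 * r))
    (hmono : ∀ r, r ≤ 2 * r₀ → F r ≤ F (2 * r₀)) (hnonneg : 0 ≤ F (2 * r₀))
    {r : ℝ} (hr : 0 < r) (hrr₀ : r ≤ r₀) : F r ≤ r ^ N / r₀ ^ N * F (2 * r₀) := by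
  have hiter : ∀ k : ℕ, ∀ s, 0 < s → 2 ^ k * s ≤ 2 * r₀ →
      F s ≤ ((1 / 2) ^ k) ^ N * F (2 ^ k * s) := by
    intro k
    induction k with
    | zero => intro s _ _; simp
    | succ k ih =>
      intro s hs hks
      have hpow : (1 : ℝ) ≤ 2 ^ k := one_le_pow₀ (by norm_num)
      rw [pow_succ] at hks
      have hss : s ≤ r₀ := by nlinarith
      calc F s ≤ (1 / 2) ^ N * F (2 * s) := hF s hs hss
        _ ≤ (1 / 2) ^ N * (((1 / 2) ^ k) ^ N * F (2 ^ k * (2 * s))) := by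
          gcongr
          exact ih (2 * s) (by linarith) (by linarith)
        _ = _ := by
          rw [show (2 : ℝ) ^ (k + 1) * s = 2 ^ k * (2 * s) by ring, pow_succ (1 / 2 : ℝ) k, mul_pow]
          ring
  have hr₀ : 0 < r₀ := hr.trans_le hrr₀
  obtain ⟨n, hn, hn'⟩ := exists_nat_pow_near ((one_le_div hr).2 hrr₀) (one_lt_two : (1 : ℝ) < 2)
  rw [le_div_iff₀ hr] at hn
  rw [div_lt_iff₀ hr] at hn'
  have hle : 2 ^ (n + 1) * r ≤ 2 * r₀ := by rw [pow_succ]; linarith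
  calc F r ≤ ((1 / 2) ^ (n + 1)) ^ N * F (2 ^ (n + 1) * r) := hiter _ r hr hle
    _ ≤ ((1 / 2) ^ (n + 1)) ^ N * F (2 * r₀) := by gcongr; exact hmono _ hle
    _ ≤ (r / r₀) ^ N * F (2 * r₀) := by
      gcongr
      rw [one_div, inv_pow, inv_le_iff_one_le_mul₀ (by positivity), div_mul_eq_mul_div,
        one_le_div hr₀]
      linarith
    _ = _ := by rw [div_pow]

end Auxiliary

/-- **zeros of infinite order.** If `ω ∈ L²_loc(Ω)` satisfies a weak
reverse Hölder inequality, then almost every zero of `ω` is a zero of infinite order: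
for a.e. `z₀` with `ω(z₀) = 0` and every `N ≥ 1` there is `r₀ > 0` with
`D(z₀, 2r₀) ⊆ Ω` such that `∫_{D(z₀,r)} |ω| ≤ (r^N/r₀^N)∫_{D(z₀,2r₀)} |ω|` for all
`0 < r ≤ r₀`. -/
theorem wrh_zeros_infinite_order
    (Ω : Set ℂ) (hΩopen : IsOpen Ω) (hΩconn : IsConnected Ω)
    (ω : ℂ → ℝ) (hω : MemL2LocR Ω ω)
    (c : ℝ) (hwrh : WeakReverseHolder Ω ω c) :
    ∀ᵐ z₀ ∂(volume.restrict {z ∈ Ω | ω z = 0}),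
      ∀ N : ℕ, 0 < N →
        ∃ r₀ : ℝ, 0 < r₀ ∧ ball z₀ (2 * r₀) ⊆ Ω ∧
          ∀ r : ℝ, 0 < r → r ≤ r₀ →
            ∫ z in ball z₀ r, |ω z| ≤
              (r ^ N / r₀ ^ N) * ∫ z in ball z₀ (2 * r₀), |ω z| := by
  have hΩae : ∀ᵐ z ∂(volume.restrict {z ∈ Ω | ω z = 0}), z ∈ Ω :=
    ae_mono (Measure.restrict_mono_set volume fun z hz => hz.1)
      (ae_restrict_mem hΩopen.measurableSet)
  filter_upwards [hΩae, Besicovitch.ae_tendsto_measure_inter_div volume {z ∈ Ω | ω z = 0}]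
    with a haΩ hdens N _
  obtain ⟨R, hR, hRΩ⟩ := nhds_basis_closedBall.mem_iff.1 (hΩopen.mem_nhds haΩ)
  set ε : ℝ := (1 / 2) ^ (2 * N) / (Real.pi * (c ^ 2 + 1))
  have hε : 0 < ε := by positivity
  have hlim : (1 : ENNReal) - ENNReal.ofReal ε < 1 :=
    ENNReal.sub_lt_self ENNReal.one_ne_top one_ne_zero (by simpa using hε)
  obtain ⟨δ, hδ, hδdens⟩ := mem_nhdsGT_iff_exists_Ioc_subset.1
    (hdens.eventually (lt_mem_nhds hlim))
  have hδ : 0 < δ := hδ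
  refine ⟨min δ (R / 2), by positivity, ?_, ?_⟩
  · refine (ball_subset_closedBall.trans (closedBall_subset_closedBall ?_)).trans hRΩ
    linarith [min_le_right δ (R / 2)]
  set r₀ := min δ (R / 2)
  have hr₀R : 2 * r₀ ≤ R := by linarith [min_le_right δ (R / 2)]
  have hsub : ∀ r, r ≤ 2 * r₀ → ball a r ⊆ closedBall a R := fun r hr =>
    ball_subset_closedBall.trans (closedBall_subset_closedBall (hr.trans hr₀R))
  intro r hr hrr₀
  refine le_pow_mul_of_doubling (F := fun r => ∫ z in ball a r, |ω z|) ?_ ?_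
    (integral_nonneg fun z => abs_nonneg _) hr hrr₀
  · intro s hs hsr₀
    have hK : closedBall a s ⊆ Ω := (closedBall_subset_closedBall (by linarith)).trans hRΩ
    have hvol : volume (closedBall a s) = ENNReal.ofReal (Real.pi * s ^ 2) := by
      rw [Complex.volume_closedBall, mul_comm Real.pi, ENNReal.ofReal_mul (by positivity),
        ENNReal.ofReal_pow hs.le]
      congr 1
      exact (ENNReal.ofReal_coe_nnreal (p := NNReal.pi)).symm
    have hsupp : volume.restrict (closedBall a s) {z | ω z ≠ 0} ≤
        ENNReal.ofReal (ε * Real.pi * s ^ 2) := by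
      have hpos : volume (closedBall a s) ≠ 0 := (measure_closedBall_pos _ _ hs).ne'
      have htop : volume (closedBall a s) ≠ ⊤ := measure_closedBall_lt_top.ne
      have hratio : 1 - ENNReal.ofReal ε <
          volume ({z ∈ Ω | ω z = 0} ∩ closedBall a s) / volume (closedBall a s) :=
        hδdens ⟨hs, hsr₀.trans (min_le_left _ _)⟩
      have hsum := hω.measure_support_add_zeros hK (isCompact_closedBall a s)
      have hone : 1 ≤ volume ({z ∈ Ω | ω z = 0} ∩ closedBall a s) / volume (closedBall a s)
          + ENNReal.ofReal ε := tsub_le_iff_right.1 hratio.le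
      have hmul := mul_le_mul_left hone (volume (closedBall a s))
      rw [one_mul, add_mul, ENNReal.div_mul_cancel hpos htop] at hmul
      nth_rw 1 [← hsum] at hmul
      have hcancel := (ENNReal.add_le_add_iff_left
        (measure_ne_top_of_subset Set.inter_subset_right htop)).1 hmul
      rwa [hvol, ← ENNReal.ofReal_mul hε.le, ← mul_assoc] at hcancel
    have hsq := hwrh.sq_integral_abs_le hω hs
      ((hsub (2 * s) (by linarith)).trans hRΩ) hsupp (by positivity)
    have hconst : ε * Real.pi * c ^ 2 ≤ ((1 / 2) ^ N) ^ 2 := by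
      have : ε * Real.pi * (c ^ 2 + 1) = ((1 / 2) ^ N) ^ 2 := by
        simp only [ε]
        rw [← pow_mul, mul_comm N 2]
        field_simp
      rw [← this]
      gcongr
      linarith
    refine (pow_le_pow_iff_left₀ (integral_nonneg fun z => abs_nonneg _)
      (mul_nonneg (by positivity) (integral_nonneg fun z => abs_nonneg _)) two_ne_zero).1
      (hsq.trans ?_)
    rw [mul_pow]
    gcongr
  · intro s hs
    exact setIntegral_mono_set ((hω.integrableOn_abs hRΩ (isCompact_closedBall a R)).mono_set
      (hsub _ le_rfl)) (Filter.Eventually.of_forall fun z => abs_nonneg _)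
      (ball_subset_ball hs).eventuallyLE
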